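/- Let (Ω, μ) be a probability space, d ≥ 0 a real number, (S_k)_{k∈ℕ} and (A_k)_{k∈ℕ} sequences of nonnegative integrable random variables (the total packet waiting time and the number of packet arrivals in frame k, respectively), and (r_k)_{k∈ℕ} a real sequence with 0 ≤ r_k ≤ d for all k. Define the virtual queue pathwise by Y_0(ω) = 0 and Y_{k+1}(ω) = max(Y_k(ω) + S_k(ω) − A_k(ω)·r_k, 0). If the virtual queue is mean rate stable, i.e. lim_{K→∞} E[Y_K]/K = 0, and liminf_{K→∞} (1/K)·∑_{k<K} E[A_k] > 0, then limsup_{K→∞} (∑_{k<K} E[S_k]) / (∑_{k<K} E[A_k]) ≤ d. -/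

import Mathlib

open MeasureTheory Filter

/-- A real function with positive `liminf` along a filter is eventually bounded below by a positive constant. -/
lemma exists_pos_eventually_le_of_liminf_pos {α : Type*} {l : Filter α} {u : α → ℝ}
    (h : 0 < liminf u l) : ∃ c, 0 < c ∧ ∀ᶠ x in l, c ≤ u x := by
  by_contra! hc
  rw [liminf_eq] at h
  refine h.not_ge (Real.sSup_nonpos fun a ha => ?_)
  by_contra! hpos
  exact hc a hpos (Eventually.mono ha fun _ => not_lt.2)

/-- A queue with increments `x k` that is reflected at `0` dominates the sum of its increments. -/
lemma sum_range_le_reflected {x y : ℕ → ℝ} (h0 : y 0 = 0)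
    (hrec : ∀ k, y (k + 1) = max (y k + x k) 0) (K : ℕ) :
    ∑ k ∈ Finset.range K, x k ≤ y K := by
  induction K with
  | zero => simp [h0]
  | succ K ih =>
    rw [Finset.sum_range_succ, hrec]
    exact le_max_of_le_left (by linarith)

/-- Lemma 1 of the paper: if the virtual delay queue
`Y₀ = 0`, `Y_{k+1}(ω) = max (Y_k(ω) + S_k(ω) − A_k(ω)·r_k) 0`
(with auxiliary variables `r_k ∈ [0, d]`) is mean rate stable and the
long-run average arrival rate is positive, then the time-average delay
satisfies `limsup (∑_{k<K} E[S_k]) / (∑_{k<K} E[A_k]) ≤ d`. -/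
theorem mean_rate_stable_implies_avg_delay_le
    {Ω : Type*} [MeasurableSpace Ω] (μ : Measure Ω) [IsProbabilityMeasure μ]
    (d : ℝ) (hd : 0 ≤ d)
    (S A : ℕ → Ω → ℝ)
    (hSnn : ∀ k ω, 0 ≤ S k ω) (hAnn : ∀ k ω, 0 ≤ A k ω)
    (hSint : ∀ k, Integrable (S k) μ) (hAint : ∀ k, Integrable (A k) μ)
    (r : ℕ → ℝ) (hr : ∀ k, r k ∈ Set.Icc 0 d)
    (Y : ℕ → Ω → ℝ)
    (hY0 : ∀ ω, Y 0 ω = 0)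
    (hYrec : ∀ k ω, Y (k + 1) ω = max (Y k ω + S k ω - A k ω * r k) 0)
    (hmrs : Tendsto (fun K : ℕ => (∫ ω, Y K ω ∂μ) / (K : ℝ)) atTop (nhds 0))
    (harr : 0 < liminf
      (fun K : ℕ => (∑ k ∈ Finset.range K, ∫ ω, A k ω ∂μ) / (K : ℝ)) atTop) :
    limsup
      (fun K : ℕ =>
        (∑ k ∈ Finset.range K, ∫ ω, S k ω ∂μ) /
          (∑ k ∈ Finset.range K, ∫ ω, A k ω ∂μ)) atTop ≤ d := by
  have hYint : ∀ k, Integrable (Y k) μ := by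
    intro k
    induction k with
    | zero => simp [funext hY0]
    | succ k ih =>
      rw [funext (hYrec k)]
      exact ((ih.add (hSint k)).sub ((hAint k).mul_const (r k))).pos_part
  have hAE : ∀ k, 0 ≤ ∫ ω, A k ω ∂μ := fun k => integral_nonneg (hAnn k)
  have hSE : ∀ k, 0 ≤ ∫ ω, S k ω ∂μ := fun k => integral_nonneg (hSnn k)
  have hbound : ∀ K, ∑ k ∈ Finset.range K, ∫ ω, S k ω ∂μ ≤
      (∫ ω, Y K ω ∂μ) + d * ∑ k ∈ Finset.range K, ∫ ω, A k ω ∂μ := by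
    intro K
    have hincr : ∀ k, Integrable (fun ω => S k ω - A k ω * r k) μ :=
      fun k => (hSint k).sub ((hAint k).mul_const (r k))
    have hle : ∑ k ∈ Finset.range K, ∫ ω, (S k ω - A k ω * r k) ∂μ ≤ ∫ ω, Y K ω ∂μ := by
      rw [← integral_finsetSum _ fun k _ => hincr k]
      refine integral_mono (integrable_finsetSum _ fun k _ => hincr k) (hYint K) fun ω => ?_
      exact sum_range_le_reflected (y := fun k => Y k ω) (hY0 ω)
        (fun k => by rw [hYrec, add_sub_assoc]) K
    have hterm : ∀ k, (∫ ω, S k ω ∂μ) - d * ∫ ω, A k ω ∂μ ≤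
        ∫ ω, (S k ω - A k ω * r k) ∂μ := by
      intro k
      rw [integral_sub (hSint k) ((hAint k).mul_const _), integral_mul_const]
      nlinarith [mul_le_mul_of_nonneg_left (hr k).2 (hAE k)]
    have hsum := (Finset.sum_le_sum fun k (_ : k ∈ Finset.range K) => hterm k).trans hle
    rw [Finset.sum_sub_distrib, ← Finset.mul_sum] at hsum
    linarith
  obtain ⟨c, hc, hcA⟩ := exists_pos_eventually_le_of_liminf_pos harr
  refine le_of_forall_pos_le_add fun ε hε => ?_
  have hcobdd : IsCoboundedUnder (· ≤ ·) atTop (fun K : ℕ =>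
      (∑ k ∈ Finset.range K, ∫ ω, S k ω ∂μ) / (∑ k ∈ Finset.range K, ∫ ω, A k ω ∂μ)) :=
    isCoboundedUnder_le_of_le atTop (x := 0) fun K => div_nonneg
      (Finset.sum_nonneg fun k _ => hSE k) (Finset.sum_nonneg fun k _ => hAE k)
  refine limsup_le_of_le hcobdd ?_
  filter_upwards [hcA, hmrs.eventually_le_const (mul_pos hε hc), eventually_gt_atTop 0]
    with K hA hY hK
  have hK' : (0 : ℝ) < K := by exact_mod_cast hK
  rw [le_div_iff₀ hK'] at hA
  rw [div_le_iff₀ hK'] at hY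
  rw [div_le_iff₀ ((mul_pos hc hK').trans_le hA)]
  nlinarith [hbound K, mul_le_mul_of_nonneg_left hA hε.le]
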